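/- Let B(ξ) = Σ_{|β|=l} ξ^β B_β be an l-homogeneous symbol on ℝ^n with values in Lin(V,W), of constant rank r ≥ 1 on ℝ^n \ {0}. Set N = dim W and define e_0(ξ),…,e_N(ξ) by det(λ Id_W − B(ξ)B(ξ)*) = Σ_{j=0}^N (−1)^j e_j(ξ) λ^{N−j}. Then the map A(ξ) := e_r(ξ)(Id_W − B(ξ)B†(ξ)), where B†(ξ) is the Moore–Penrose pseudoinverse of B(ξ), has all matrix entries equal to homogeneous polynomials in ξ of degree 2lr, and satisfies ker A(ξ) = im B(ξ) for every ξ ∈ ℝ^n \ {0}. -/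

import Mathlib

open scoped BigOperators

/-- The symbol of a homogeneous constant-coefficient linear differential operator:
`B(ξ) = ∑_{|β| = l} ξ^β B_β`. -/
noncomputable def symbolOf {n : ℕ} {V W : Type*} [AddCommGroup V] [Module ℝ V]
    [AddCommGroup W] [Module ℝ W]
    (l : ℕ) (coef : (Fin n → ℕ) → (V →ₗ[ℝ] W)) (ξ : Fin n → ℝ) : V →ₗ[ℝ] W :=
  ∑ β ∈ Finset.Nat.antidiagonalTuple n l, (∏ i, ξ i ^ β i) • coef β

/-- `f` is given by a homogeneous polynomial of degree `d` in the coordinates. -/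
def IsHomogeneousPolynomialMap {n : ℕ} (d : ℕ) (f : (Fin n → ℝ) → ℝ) : Prop :=
  ∃ p : MvPolynomial (Fin n) ℝ, p.IsHomogeneous d ∧ ∀ ξ, f ξ = MvPolynomial.eval ξ p

namespace IsHomogeneousPolynomialMap

variable {n : ℕ}

theorem mul {d d' : ℕ} {f g : (Fin n → ℝ) → ℝ} (hf : IsHomogeneousPolynomialMap d f)
    (hg : IsHomogeneousPolynomialMap d' g) :
    IsHomogeneousPolynomialMap (d + d') (fun ξ => f ξ * g ξ) := by
  obtain ⟨p, hp, hpf⟩ := hf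
  obtain ⟨q, hq, hqg⟩ := hg
  exact ⟨p * q, hp.mul hq, fun ξ => by simp only [map_mul, hpf, hqg]⟩

theorem const (c : ℝ) : IsHomogeneousPolynomialMap 0 (fun _ : Fin n → ℝ => c) :=
  ⟨MvPolynomial.C c, MvPolynomial.isHomogeneous_C _ _, fun ξ => by simp⟩

theorem sum {d : ℕ} {ι : Type*} (s : Finset ι) {f : ι → (Fin n → ℝ) → ℝ}
    (hf : ∀ i ∈ s, IsHomogeneousPolynomialMap d (f i)) :
    IsHomogeneousPolynomialMap d (fun ξ => ∑ i ∈ s, f i ξ) := by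
  choose! p hp hpf using hf
  refine ⟨∑ i ∈ s, p i, MvPolynomial.IsHomogeneous.sum _ _ _ hp, fun ξ => ?_⟩
  rw [map_sum]
  exact Finset.sum_congr rfl fun i hi => hpf i hi ξ

theorem prod_pow (β : Fin n → ℕ) :
    IsHomogeneousPolynomialMap (∑ i, β i) (fun ξ : Fin n → ℝ => ∏ i, ξ i ^ β i) :=
  ⟨∏ i, MvPolynomial.X i ^ β i,
    MvPolynomial.IsHomogeneous.prod _ _ _ fun i _ => MvPolynomial.isHomogeneous_X_pow i (β i),
    fun ξ => by simp⟩

end IsHomogeneousPolynomialMap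

theorem MvPolynomial.IsHomogeneous.eval_zero_eq_zero {n d : ℕ} (hd : d ≠ 0)
    {p : MvPolynomial (Fin n) ℝ} (hp : p.IsHomogeneous d) :
    MvPolynomial.eval (0 : Fin n → ℝ) p = 0 := by
  rw [MvPolynomial.eval_zero]
  exact hp.coeff_eq_zero (by simpa using hd.symm)

section PolynomialFamilies

variable {n : ℕ} {V W : Type*}
    [NormedAddCommGroup V] [InnerProductSpace ℝ V]
    [NormedAddCommGroup W] [InnerProductSpace ℝ W]

theorem isHomogeneousPolynomialMap_symbolOf (l : ℕ) (coef : (Fin n → ℕ) → (V →ₗ[ℝ] W))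
    (φ : W →ₗ[ℝ] ℝ) (v : V) :
    IsHomogeneousPolynomialMap l (fun ξ => φ (symbolOf l coef ξ v)) := by
  have h : (fun ξ => φ (symbolOf l coef ξ v)) = fun ξ : Fin n → ℝ =>
      ∑ β ∈ Finset.Nat.antidiagonalTuple n l, (∏ i, ξ i ^ β i) * φ (coef β v) := by
    ext ξ
    simp [symbolOf, LinearMap.sum_apply]
  rw [h]
  refine .sum _ fun β hβ => ?_
  have := (IsHomogeneousPolynomialMap.prod_pow β).mul (.const (φ (coef β v)))
  rwa [add_zero, Finset.Nat.mem_antidiagonalTuple.mp hβ] at this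

variable [FiniteDimensional ℝ V] [FiniteDimensional ℝ W]

theorem isHomogeneousPolynomialMap_comp_adjoint {d : ℕ} {B : (Fin n → ℝ) → (V →ₗ[ℝ] W)}
    (hB : ∀ (φ : W →ₗ[ℝ] ℝ) (v : V), IsHomogeneousPolynomialMap d (fun ξ => φ (B ξ v)))
    (φ : W →ₗ[ℝ] ℝ) (w : W) :
    IsHomogeneousPolynomialMap (2 * d)
      (fun ξ => φ ((B ξ ∘ₗ LinearMap.adjoint (B ξ)) w)) := by
  have h : (fun ξ => φ ((B ξ ∘ₗ LinearMap.adjoint (B ξ)) w)) = fun ξ : Fin n → ℝ =>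
      ∑ i, φ (B ξ (stdOrthonormalBasis ℝ V i)) *
        innerₛₗ ℝ w (B ξ (stdOrthonormalBasis ℝ V i)) := by
    ext ξ
    conv_lhs => rw [LinearMap.comp_apply,
      ← (stdOrthonormalBasis ℝ V).sum_repr' (LinearMap.adjoint (B ξ) w)]
    simp only [map_sum, map_smul, smul_eq_mul, LinearMap.adjoint_inner_right, innerₛₗ_apply_apply]
    refine Finset.sum_congr rfl fun i _ => ?_
    rw [mul_comm, real_inner_comm]
  rw [h, two_mul]
  exact .sum _ fun i _ => (hB _ _).mul (hB _ _)

theorem isHomogeneousPolynomialMap_pow {d : ℕ} {T : (Fin n → ℝ) → Module.End ℝ W}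
    (hT : ∀ (φ : W →ₗ[ℝ] ℝ) (w : W), IsHomogeneousPolynomialMap d (fun ξ => φ (T ξ w)))
    (k : ℕ) (φ : W →ₗ[ℝ] ℝ) (w : W) :
    IsHomogeneousPolynomialMap (d * k) (fun ξ => φ ((T ξ ^ k) w)) := by
  induction k generalizing φ with
  | zero => simpa using IsHomogeneousPolynomialMap.const (φ w)
  | succ k ih =>
    let b := Module.finBasis ℝ W
    have h : (fun ξ => φ ((T ξ ^ (k + 1)) w)) = fun ξ : Fin n → ℝ =>
        ∑ i, b.coord i ((T ξ ^ k) w) * φ (T ξ (b i)) := by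
      ext ξ
      rw [pow_succ', Module.End.mul_apply]
      conv_lhs => rw [← b.sum_repr ((T ξ ^ k) w)]
      simp only [map_sum, map_smul, smul_eq_mul, Module.Basis.coord_apply]
    rw [h, mul_add, mul_one]
    exact .sum _ fun i _ => (ih _).mul (hT _ _)

theorem isHomogeneousPolynomialMap_charpoly_coeff {d : ℕ} {T : (Fin n → ℝ) → Module.End ℝ W}
    (hT : ∀ (φ : W →ₗ[ℝ] ℝ) (w : W), IsHomogeneousPolynomialMap d (fun ξ => φ (T ξ w)))
    {i j : ℕ} (hij : i + j = Module.finrank ℝ W) :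
    IsHomogeneousPolynomialMap (d * j) (fun ξ => (T ξ).charpoly.coeff i) := by
  let b := Module.finBasis ℝ W
  choose p hp hpT using fun ij : Fin (Module.finrank ℝ W) × Fin (Module.finrank ℝ W) =>
    hT (b.coord ij.1) (b ij.2)
  refine ⟨MvPolynomial.aeval p ((Matrix.charpoly.univ ℝ _).coeff i),
    (Matrix.charpoly.univ_coeff_isHomogeneous ℝ _ i j (by simpa using hij)).aeval p hp,
    fun ξ => ?_⟩
  have h := Matrix.charpoly.univ_coeff_eval₂Hom (Fin (Module.finrank ℝ W)) (RingHom.id ℝ)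
    (fun ij => MvPolynomial.eval ξ (p ij)) i
  have hM : Matrix.of (Function.curry fun ij => MvPolynomial.eval ξ (p ij))
      = LinearMap.toMatrix b b (T ξ) := by
    ext k m
    simp [LinearMap.toMatrix_apply, ← hpT]
  rw [hM, LinearMap.charpoly_toMatrix] at h
  beta_reduce
  rw [← h, MvPolynomial.map_aeval]
  congr 2
  ext x
  simp

end PolynomialFamilies

section Pseudoinverse

variable {V W : Type*}
    [NormedAddCommGroup V] [InnerProductSpace ℝ V]
    [NormedAddCommGroup W] [InnerProductSpace ℝ W]

theorem LinearMap.ker_smul_id_sub_comp_pseudoinverse {B : V →ₗ[ℝ] W} {C : W →ₗ[ℝ] V}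
    (h₁ : B ∘ₗ C ∘ₗ B = B) {c : ℝ} (hc : c ≠ 0) :
    LinearMap.ker (c • ((LinearMap.id : W →ₗ[ℝ] W) - B ∘ₗ C)) = LinearMap.range B := by
  rw [LinearMap.ker_smul _ _ hc]
  ext w
  simp only [LinearMap.mem_ker, LinearMap.sub_apply, LinearMap.id_apply, LinearMap.comp_apply,
    sub_eq_zero, LinearMap.mem_range]
  constructor
  · exact fun h => ⟨C w, h.symm⟩
  · rintro ⟨v, rfl⟩
    exact (LinearMap.congr_fun h₁ v).symm

theorem LinearMap.IsSymmetric.maxGenEigenspace_zero {T : Module.End ℝ W} (hT : T.IsSymmetric) :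
    T.maxGenEigenspace 0 = LinearMap.ker T := by
  rw [hT.isFinitelySemisimple.maxGenEigenspace_eq_eigenspace, Module.End.eigenspace_zero]

variable [FiniteDimensional ℝ V] [FiniteDimensional ℝ W]

theorem LinearMap.isSymmetric_comp_adjoint (B : V →ₗ[ℝ] W) :
    (B ∘ₗ LinearMap.adjoint B).IsSymmetric := by
  intro x y
  rw [LinearMap.comp_apply, LinearMap.comp_apply, ← LinearMap.adjoint_inner_right,
    LinearMap.adjoint_inner_left]

theorem LinearMap.natTrailingDegree_charpoly_comp_adjoint (B : V →ₗ[ℝ] W) :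
    (B ∘ₗ LinearMap.adjoint B).charpoly.natTrailingDegree + Module.finrank ℝ (LinearMap.range B)
      = Module.finrank ℝ W := by
  rw [← LinearMap.finrank_maxGenEigenspace_zero_eq,
    B.isSymmetric_comp_adjoint.maxGenEigenspace_zero, LinearMap.ker_self_comp_adjoint,
    ← LinearMap.orthogonal_range, add_comm, Submodule.finrank_add_finrank_orthogonal]

theorem LinearMap.IsSymmetric.apply_aeval_eq_zero {T : Module.End ℝ W} (hT : T.IsSymmetric)
    {q : Polynomial ℝ} {k : ℕ} (hq : T.charpoly = Polynomial.X ^ k * q) (w : W) :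
    T (Polynomial.aeval T q w) = 0 := by
  rw [← LinearMap.mem_ker, ← hT.maxGenEigenspace_zero, Module.End.mem_maxGenEigenspace]
  refine ⟨k, ?_⟩
  have h := T.aeval_self_charpoly
  rw [hq, map_mul, map_pow, Polynomial.aeval_X] at h
  simpa using LinearMap.congr_fun h w

/-- If `B†` satisfies the Penrose identities then the orthogonal projection `1 - B B†`, scaled by
the lowest nonzero coefficient of the characteristic polynomial of `B B*`, is a polynomial in
`B B*`. -/
theorem LinearMap.charpoly_coeff_smul_one_sub_comp_pseudoinverse {B : V →ₗ[ℝ] W} {C : W →ₗ[ℝ] V}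
    (h₁ : B ∘ₗ C ∘ₗ B = B) (h₂ : C ∘ₗ B ∘ₗ C = C)
    (h₃ : LinearMap.adjoint (B ∘ₗ C) = B ∘ₗ C) (h₄ : LinearMap.adjoint (C ∘ₗ B) = C ∘ₗ B)
    {k r : ℕ} (hr : Module.finrank ℝ (LinearMap.range B) = r) (hk : k + r = Module.finrank ℝ W) :
    (B ∘ₗ LinearMap.adjoint B).charpoly.coeff k • ((LinearMap.id : W →ₗ[ℝ] W) - B ∘ₗ C)
      = ∑ i ∈ Finset.range (r + 1), (B ∘ₗ LinearMap.adjoint B).charpoly.coeff (i + k) •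
          ((B ∘ₗ LinearMap.adjoint B : Module.End ℝ W) ^ i) := by
  set T : Module.End ℝ W := B ∘ₗ LinearMap.adjoint B with hT
  have hsymm : T.IsSymmetric := B.isSymmetric_comp_adjoint
  have htd : T.charpoly.natTrailingDegree = k := by
    have h := B.natTrailingDegree_charpoly_comp_adjoint
    rw [← hT] at h
    omega
  obtain ⟨q, hq⟩ : Polynomial.X ^ k ∣ T.charpoly := by
    rw [Polynomial.X_pow_dvd_iff]
    exact fun d hd => Polynomial.coeff_eq_zero_of_lt_natTrailingDegree (htd ▸ hd)
  have hcoeff (i : ℕ) : T.charpoly.coeff (i + k) = q.coeff i := by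
    rw [hq, Polynomial.coeff_X_pow_mul]
  have hdeg : q.natDegree < r + 1 := by
    have h := T.charpoly_natDegree
    have hq0 : q ≠ 0 := by
      rintro rfl
      exact T.charpoly_monic.ne_zero (by simpa using hq)
    rw [hq, Polynomial.natDegree_mul (pow_ne_zero _ Polynomial.X_ne_zero) hq0,
      Polynomial.natDegree_X_pow] at h
    omega
  have hsum : ∑ i ∈ Finset.range (r + 1), T.charpoly.coeff (i + k) • T ^ i
      = Polynomial.aeval T q := by
    rw [Polynomial.aeval_eq_sum_range' hdeg]
    simp_rw [hcoeff]
  have hc : T.charpoly.coeff k = q.coeff 0 := by simpa using hcoeff 0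
  rw [hsum, hc]
  have hproj : B ∘ₗ C = T ∘ₗ (LinearMap.adjoint C ∘ₗ C) := by
    have h : LinearMap.adjoint B ∘ₗ LinearMap.adjoint C = C ∘ₗ B := by
      rw [← LinearMap.adjoint_comp, h₄]
    calc B ∘ₗ C = B ∘ₗ (C ∘ₗ B) ∘ₗ C := by rw [LinearMap.comp_assoc, h₂]
      _ = T ∘ₗ (LinearMap.adjoint C ∘ₗ C) := by rw [← h]; rfl
  ext w
  have hzero : Polynomial.aeval T q (B (C w)) = 0 := by
    have hcomm : Polynomial.aeval T q * T = T * Polynomial.aeval T q := by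
      have := congrArg (Polynomial.aeval T) (mul_comm q Polynomial.X)
      simpa using this
    have hw : B (C w) = T ((LinearMap.adjoint C ∘ₗ C) w) := LinearMap.congr_fun hproj w
    rw [hw, ← Module.End.mul_apply, hcomm, Module.End.mul_apply, hsymm.apply_aeval_eq_zero hq]
  have hker : T (w - B (C w)) = 0 := by
    have h : LinearMap.adjoint B ∘ₗ (B ∘ₗ C) = LinearMap.adjoint B := by
      conv_rhs => rw [← h₁, ← LinearMap.comp_assoc, LinearMap.adjoint_comp, h₃]
    have hw : LinearMap.adjoint B (B (C w)) = LinearMap.adjoint B w := LinearMap.congr_fun h w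
    simp [hT, hw]
  have hev : Polynomial.aeval T q (w - B (C w)) = q.coeff 0 • (w - B (C w)) := by
    conv_lhs => rw [← Polynomial.divX_mul_X_add q]
    simp [hker, -map_sub]
  rw [map_sub, hzero, sub_zero] at hev
  simpa using hev.symm

theorem LinearMap.charpoly_coeff_comp_adjoint_ne_zero {B : V →ₗ[ℝ] W} {k r : ℕ}
    (hr : Module.finrank ℝ (LinearMap.range B) = r) (hk : k + r = Module.finrank ℝ W) :
    (B ∘ₗ LinearMap.adjoint B).charpoly.coeff k ≠ 0 := by
  have htd : (B ∘ₗ LinearMap.adjoint B).charpoly.natTrailingDegree = k := by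
    have := B.natTrailingDegree_charpoly_comp_adjoint
    omega
  rw [← htd]
  exact Polynomial.trailingCoeff_nonzero_iff_nonzero.mpr (LinearMap.charpoly_monic _).ne_zero

theorem LinearMap.charpoly_coeff_eq_of_det_eq_sum {T : Module.End ℝ W} {N : ℕ} {e : ℕ → ℝ}
    (h : ∀ t : ℝ, LinearMap.det (t • (LinearMap.id : W →ₗ[ℝ] W) - T)
      = ∑ j ∈ Finset.range (N + 1), (-1 : ℝ) ^ j * e j * t ^ (N - j))
    {k r : ℕ} (hk : k + r = N) : T.charpoly.coeff k = (-1) ^ r * e r := by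
  have hp : T.charpoly = ∑ j ∈ Finset.range (N + 1),
      Polynomial.C ((-1 : ℝ) ^ j * e j) * Polynomial.X ^ (N - j) := by
    refine Polynomial.funext fun t => ?_
    rw [LinearMap.eval_charpoly, Polynomial.eval_finsetSum]
    simpa [Module.algebraMap_end_eq_smul_id] using h t
  rw [hp, Polynomial.finsetSum_coeff, Finset.sum_eq_single r]
  · rw [Polynomial.coeff_C_mul_X_pow, if_pos (by omega)]
  · intro j hj hjr
    rw [Finset.mem_range] at hj
    rw [Polynomial.coeff_C_mul_X_pow, if_neg (by omega)]
  · intro hr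
    exact absurd (Finset.mem_range.mpr (by omega)) hr

end Pseudoinverse

/-- **Construction of the annihilator.** Let `B(ξ)` be an `l`-homogeneous symbol with
values in `Lin(V, W)`, of constant rank `r ≥ 1` on `ℝ^n \ {0}`, let `N = dim W`, let
`e_0(ξ), …, e_N(ξ)` be defined by
`det(λ Id_W − B(ξ)B(ξ)*) = ∑_{j=0}^N (−1)^j e_j(ξ) λ^{N−j}`, and let `B†(ξ)` be the
Moore–Penrose pseudoinverse of `B(ξ)`. Then `A(ξ) := e_r(ξ) (Id_W − B(ξ) B†(ξ))` has all
matrix entries homogeneous polynomials in `ξ` of degree `2lr`, and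
`ker A(ξ) = im B(ξ)` for all `ξ ≠ 0`. -/
theorem annihilator_polynomial_and_exact
    {n l : ℕ} (hn : 1 ≤ n) (hl : 1 ≤ l)
    {V W : Type*}
    [NormedAddCommGroup V] [InnerProductSpace ℝ V] [FiniteDimensional ℝ V]
    [NormedAddCommGroup W] [InnerProductSpace ℝ W] [FiniteDimensional ℝ W]
    (Bcoef : (Fin n → ℕ) → (V →ₗ[ℝ] W))
    (B : (Fin n → ℝ) → (V →ₗ[ℝ] W)) (hB : ∀ ξ, B ξ = symbolOf l Bcoef ξ)
    (r : ℕ) (hr : 1 ≤ r)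
    (hrank : ∀ ξ : Fin n → ℝ, ξ ≠ 0 → Module.finrank ℝ (LinearMap.range (B ξ)) = r)
    (N : ℕ) (hN : N = Module.finrank ℝ W)
    (e : ℕ → (Fin n → ℝ) → ℝ)
    (he : ∀ (ξ : Fin n → ℝ) (lam : ℝ),
      LinearMap.det (lam • (LinearMap.id : W →ₗ[ℝ] W) - (B ξ) ∘ₗ (LinearMap.adjoint (B ξ)))
        = ∑ j ∈ Finset.range (N + 1), (-1 : ℝ) ^ j * e j ξ * lam ^ (N - j))
    (Bdag : (Fin n → ℝ) → (W →ₗ[ℝ] V))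
    (hdag : ∀ ξ : Fin n → ℝ,
      (B ξ) ∘ₗ (Bdag ξ) ∘ₗ (B ξ) = B ξ ∧
      (Bdag ξ) ∘ₗ (B ξ) ∘ₗ (Bdag ξ) = Bdag ξ ∧
      LinearMap.adjoint ((B ξ) ∘ₗ (Bdag ξ)) = (B ξ) ∘ₗ (Bdag ξ) ∧
      LinearMap.adjoint ((Bdag ξ) ∘ₗ (B ξ)) = (Bdag ξ) ∘ₗ (B ξ))
    (A : (Fin n → ℝ) → (W →ₗ[ℝ] W))
    (hA : ∀ ξ, A ξ = e r ξ • ((LinearMap.id : W →ₗ[ℝ] W) - (B ξ) ∘ₗ (Bdag ξ))) :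
    (∀ (φ : W →ₗ[ℝ] ℝ) (w : W), ∃ p : MvPolynomial (Fin n) ℝ,
        p.IsHomogeneous (2 * l * r) ∧ ∀ ξ : Fin n → ℝ, φ (A ξ w) = MvPolynomial.eval ξ p) ∧
    (∀ ξ : Fin n → ℝ, ξ ≠ 0 → LinearMap.ker (A ξ) = LinearMap.range (B ξ)) := by
  subst hN
  obtain rfl : B = symbolOf l Bcoef := funext hB
  set H : (Fin n → ℝ) → Module.End ℝ W :=
    fun ξ => symbolOf l Bcoef ξ ∘ₗ LinearMap.adjoint (symbolOf l Bcoef ξ) with hH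
  obtain ⟨k, hk⟩ : ∃ k, k + r = Module.finrank ℝ W := by
    have hne : (fun _ : Fin n => (1 : ℝ)) ≠ 0 := fun h =>
      one_ne_zero (congrFun h ⟨0, hn⟩)
    refine ⟨Module.finrank ℝ W - r, Nat.sub_add_cancel ?_⟩
    rw [← hrank _ hne]
    exact Submodule.finrank_le _
  have hcoeff (ξ) : (H ξ).charpoly.coeff k = (-1) ^ r * e r ξ :=
    LinearMap.charpoly_coeff_eq_of_det_eq_sum (he ξ) hk
  have her (ξ) : e r ξ = (-1) ^ r * (H ξ).charpoly.coeff k := by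
    rw [hcoeff, ← mul_assoc, ← mul_pow]
    simp
  have hHpoly (φ : W →ₗ[ℝ] ℝ) (w : W) :
      IsHomogeneousPolynomialMap (2 * l) (fun ξ => φ (H ξ w)) :=
    isHomogeneousPolynomialMap_comp_adjoint (isHomogeneousPolynomialMap_symbolOf l Bcoef) φ w
  have hdeg : 2 * l * r ≠ 0 := by positivity
  refine ⟨fun φ w => ?_, fun ξ hξ => ?_⟩
  · have hsum : IsHomogeneousPolynomialMap (2 * l * r) (fun ξ => ∑ i ∈ Finset.range (r + 1),
        (-1) ^ r * ((H ξ).charpoly.coeff (i + k) * φ ((H ξ ^ i) w))) := by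
      refine .sum _ fun i hi => ?_
      have hi' : i ≤ r := Nat.lt_succ_iff.mp (Finset.mem_range.mp hi)
      have h := (IsHomogeneousPolynomialMap.const ((-1) ^ r)).mul
        ((isHomogeneousPolynomialMap_charpoly_coeff hHpoly
          (show i + k + (r - i) = Module.finrank ℝ W by omega)).mul
          (isHomogeneousPolynomialMap_pow hHpoly i φ w))
      rwa [zero_add, ← mul_add, Nat.sub_add_cancel hi'] at h
    obtain ⟨p, hp, hpeval⟩ := hsum
    refine ⟨p, hp, fun ξ => ?_⟩
    obtain rfl | hξ := eq_or_ne ξ 0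
    · obtain ⟨q, hq, hqeval⟩ := isHomogeneousPolynomialMap_charpoly_coeff hHpoly hk
      beta_reduce at hqeval
      rw [hp.eval_zero_eq_zero hdeg, hA, her, hqeval,
        hq.eval_zero_eq_zero hdeg]
      simp
    · obtain ⟨h₁, h₂, h₃, h₄⟩ := hdag ξ
      rw [← hpeval, hA, her, mul_smul,
        LinearMap.charpoly_coeff_smul_one_sub_comp_pseudoinverse h₁ h₂ h₃ h₄ (hrank ξ hξ) hk]
      simp [hH, LinearMap.sum_apply, Finset.mul_sum]
  · rw [hA, LinearMap.ker_smul_id_sub_comp_pseudoinverse (hdag ξ).1]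
    rw [her]
    exact mul_ne_zero (by simp) (LinearMap.charpoly_coeff_comp_adjoint_ne_zero (hrank ξ hξ) hk)
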